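/- arXiv:2107.03612 — 2 statements merged into one kernel-verified Lean document; each statement's English description precedes it below -/
import Mathlib

section
/- Let k be an algebraically closed field with char k ∉ {2,3}, and let a, a' ∈ k with a(a−1) ≠ 0 and a'(a'−1) ≠ 0. Then there is a graded isomorphism P(a) ≅ P(a') if and only if a' = a or a·a' = 1. -/
noncomputable section

/-- The free algebra on three generators `x, y, z` (indexed by `Fin 3`). -/
abbrev F3 (k : Type) [Field k] : Type := FreeAlgebra k (Fin 3)

noncomputable def X (k : Type) [Field k] : F3 k := FreeAlgebra.ι k 0
noncomputable def Y (k : Type) [Field k] : F3 k := FreeAlgebra.ι k 1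
noncomputable def Z (k : Type) [Field k] : F3 k := FreeAlgebra.ι k 2

/-- The quotient of the free algebra on `x, y, z` by the two-sided ideal
generated by the set `rels`. -/
abbrev quotAlg (k : Type) [Field k] (rels : Set (F3 k)) : Type :=
  RingQuot (fun a b : F3 k => a ∈ rels ∧ b = 0)

/-- The image of the `i`-th generator in the quotient algebra. -/
noncomputable def gen (k : Type) [Field k] (rels : Set (F3 k)) (i : Fin 3) :
    quotAlg k rels :=
  RingQuot.mkAlgHom k (fun a b : F3 k => a ∈ rels ∧ b = 0) (FreeAlgebra.ι k i)

/-- The `k`-linear span of the images of the generators in the quotient. -/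
noncomputable def genSpan (k : Type) [Field k] (rels : Set (F3 k)) :
    Submodule k (quotAlg k rels) :=
  Submodule.span k (Set.range (gen k rels))

/-- There is a graded isomorphism between the two quotient algebras:
a `k`-algebra isomorphism carrying the span of the generators onto the
span of the generators. -/
def GradedIso (k : Type) [Field k] (r1 r2 : Set (F3 k)) : Prop :=
  ∃ φ : quotAlg k r1 ≃ₐ[k] quotAlg k r2,
    Submodule.map φ.toLinearMap (genSpan k r1) = genSpan k r2

/-- Relations of `P(a) = k⟨r,s,t⟩/⟨rs + sr, tr + rt − t² − a·r², t(r−s) + (r−s)t + 2s²⟩`,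
with the generators `r, s, t` realized as the generators `X, Y, Z` of the free algebra. -/
noncomputable def Prel (k : Type) [Field k] (a : k) : Set (F3 k) :=
  {X k * Y k + Y k * X k,
   Z k * X k + X k * Z k - Z k ^ 2 - a • X k ^ 2,
   Z k * (X k - Y k) + (X k - Y k) * Z k + 2 * Y k ^ 2}

section

open Matrix

variable {k : Type} [Field k]

/-! ### The algebra `P(a)`: maps out of it and its components of degree at most two -/

/-- The algebra homomorphism out of `P(a)` given by images of the generators that satisfy the
defining relations. -/
def liftP {A : Type} [Ring A] [Algebra k A] (a : k) (g : Fin 3 → A)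
    (h₁ : g 0 * g 1 + g 1 * g 0 = 0)
    (h₂ : g 2 * g 0 + g 0 * g 2 - g 2 ^ 2 - a • g 0 ^ 2 = 0)
    (h₃ : g 2 * (g 0 - g 1) + (g 0 - g 1) * g 2 + 2 * g 1 ^ 2 = 0) :
    quotAlg k (Prel k a) →ₐ[k] A :=
  RingQuot.liftAlgHom k ⟨FreeAlgebra.lift k g, by
    rintro x y ⟨hx, rfl⟩
    rcases hx with rfl | rfl | rfl
    · simpa [X, Y] using h₁
    · simpa [X, Z] using h₂
    · simpa [X, Y, Z, two_mul] using h₃⟩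

@[simp]
lemma liftP_gen {A : Type} [Ring A] [Algebra k A] (a : k) (g : Fin 3 → A) (h₁ h₂ h₃) (i : Fin 3) :
    liftP a g h₁ h₂ h₃ (gen k (Prel k a) i) = g i := by
  simp [liftP, gen]

lemma mkAlgHom_eq_zero_of_mem {rels : Set (F3 k)} {x : F3 k} (hx : x ∈ rels) :
    RingQuot.mkAlgHom k (fun a b : F3 k => a ∈ rels ∧ b = 0) x = 0 := by
  rw [← map_zero (RingQuot.mkAlgHom k (fun a b : F3 k => a ∈ rels ∧ b = 0))]
  exact RingQuot.mkAlgHom_rel k ⟨hx, rfl⟩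

lemma gen_relation_xy (a : k) :
    gen k (Prel k a) 0 * gen k (Prel k a) 1 + gen k (Prel k a) 1 * gen k (Prel k a) 0 = 0 := by
  have h := mkAlgHom_eq_zero_of_mem (k := k) (rels := Prel k a) (Or.inl rfl)
  simp only [map_add, map_mul] at h
  exact h

lemma gen_relation_xz (a : k) :
    gen k (Prel k a) 2 * gen k (Prel k a) 0 + gen k (Prel k a) 0 * gen k (Prel k a) 2
      - gen k (Prel k a) 2 ^ 2 - a • gen k (Prel k a) 0 ^ 2 = 0 := by
  have h := mkAlgHom_eq_zero_of_mem (k := k) (rels := Prel k a) (Or.inr (Or.inl rfl))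
  simp only [map_add, map_sub, map_mul, map_pow, map_smul] at h
  exact h

lemma gen_relation_xyz (a : k) :
    gen k (Prel k a) 2 * (gen k (Prel k a) 0 - gen k (Prel k a) 1)
      + (gen k (Prel k a) 0 - gen k (Prel k a) 1) * gen k (Prel k a) 2
      + 2 * gen k (Prel k a) 1 ^ 2 = 0 := by
  have h := mkAlgHom_eq_zero_of_mem (k := k) (rels := Prel k a) (Or.inr (Or.inr rfl))
  simp only [map_add, map_sub, map_mul, map_pow, map_ofNat] at h
  exact h

/-- The `i`-th generator acting on `k ⊕ k³ ⊕ k`, so that `gᵢ gⱼ` has the single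
nonzero entry `B i j`. -/
def bilinRep (B : Matrix (Fin 3) (Fin 3) k) (i : Fin 3) : Matrix (Fin 5) (Fin 5) k :=
  !![0, if i = 0 then 1 else 0, if i = 1 then 1 else 0, if i = 2 then 1 else 0, 0;
     0, 0, 0, 0, B 0 i;
     0, 0, 0, 0, B 1 i;
     0, 0, 0, 0, B 2 i;
     0, 0, 0, 0, 0]

lemma bilinRep_mul (B : Matrix (Fin 3) (Fin 3) k) (i j : Fin 3) :
    bilinRep B i * bilinRep B j = Matrix.single 0 4 (B i j) := by
  ext p q
  fin_cases i <;> fin_cases p <;> fin_cases q <;>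
    simp [bilinRep, Matrix.mul_apply, Fin.sum_univ_five, Matrix.single]

/-- The relations of `P(a)` as conditions on a bilinear form. -/
def KillsRelations (a : k) (B : Matrix (Fin 3) (Fin 3) k) : Prop :=
  B 0 1 + B 1 0 = 0 ∧ B 2 0 + B 0 2 - B 2 2 - a * B 0 0 = 0 ∧
    B 2 0 - B 2 1 + (B 0 2 - B 1 2) + 2 * B 1 1 = 0

lemma exists_hom_of_killsRelations {a : k} {B : Matrix (Fin 3) (Fin 3) k}
    (hB : KillsRelations a B) :
    ∃ f : quotAlg k (Prel k a) →ₐ[k] Matrix (Fin 5) (Fin 5) k,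
      ∀ i, f (gen k (Prel k a) i) = bilinRep B i := by
  obtain ⟨h₁, h₂, h₃⟩ := hB
  refine ⟨liftP a (bilinRep B) ?_ ?_ ?_, fun i => liftP_gen ..⟩
  · simpa [bilinRep_mul, Matrix.single_add] using
      congrArg (Matrix.single (0 : Fin 5) (4 : Fin 5)) h₁
  · simpa [bilinRep_mul, sub_eq_add_neg, pow_two, Matrix.single_add, Matrix.single_neg] using
      congrArg (Matrix.single (0 : Fin 5) (4 : Fin 5)) h₂
  · simpa [bilinRep_mul, sub_eq_add_neg, pow_two, two_mul, mul_add, add_mul, Matrix.single_add,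
      Matrix.single_neg] using congrArg (Matrix.single (0 : Fin 5) (4 : Fin 5)) h₃

lemma sum_mul_eq_zero_of_killsRelations {a : k} {B : Matrix (Fin 3) (Fin 3) k}
    (hB : KillsRelations a B) {G : Matrix (Fin 3) (Fin 3) k}
    (hG : ∑ i, ∑ j, G i j • (gen k (Prel k a) i * gen k (Prel k a) j) = 0) :
    ∑ i, ∑ j, G i j * B i j = 0 := by
  obtain ⟨f, hf⟩ := exists_hom_of_killsRelations hB
  have h := congrArg (fun M => f M 0 4) hG
  simpa [hf, bilinRep_mul, Matrix.sum_apply] using h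

lemma linearIndependent_gen (a : k) : LinearIndependent k (gen k (Prel k a)) := by
  obtain ⟨f, hf⟩ := exists_hom_of_killsRelations (a := a) (B := 0) (by simp [KillsRelations])
  rw [Fintype.linearIndependent_iff]
  intro c hc
  have hc : ∑ i, c i • gen k (Prel k a) i = 0 := hc
  have h := congrArg f hc
  simp only [Fin.sum_univ_three, map_add, map_smul, hf, map_zero] at h
  intro i
  fin_cases i
  · simpa [bilinRep] using congrFun (congrFun h 0) 1
  · simpa [bilinRep] using congrFun (congrFun h 0) 2
  · simpa [bilinRep] using congrFun (congrFun h 0) 3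

/-- The linear conditions cutting out the span of the relations of `P(a)` among
symmetric matrices. -/
def InNet (a : k) (G : Matrix (Fin 3) (Fin 3) k) : Prop :=
  G 0 0 = a * G 2 2 ∧ G 1 1 = 2 * G 2 2 + 2 * G 0 2 ∧ G 1 2 = -G 2 2 - G 0 2

lemma inNet_of_sum_eq_zero {a : k} {G : Matrix (Fin 3) (Fin 3) k}
    (hG : ∑ i, ∑ j, G i j • (gen k (Prel k a) i * gen k (Prel k a) j) = 0) : InNet a G := by
  have h₁ := sum_mul_eq_zero_of_killsRelations
    (B := !![1, 0, 0; 0, 0, 0; 0, 0, -a]) (by simp [KillsRelations]) hG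
  have h₂ := sum_mul_eq_zero_of_killsRelations
    (B := !![0, 0, -2; 0, 1, 0; 0, 0, -2]) (by simp [KillsRelations]) hG
  have h₃ := sum_mul_eq_zero_of_killsRelations
    (B := !![0, 0, 1; 0, 0, 1; 0, 0, 1]) (by simp [KillsRelations]) hG
  simp [Fin.sum_univ_three] at h₁ h₂ h₃
  refine ⟨by linear_combination h₁, by linear_combination h₂, by linear_combination h₃⟩

lemma sum_eq_zero_of_inNet {a : k} {G : Matrix (Fin 3) (Fin 3) k} (hs : G.IsSymm)
    (hG : InNet a G) :
    ∑ i, ∑ j, G i j • (gen k (Prel k a) i * gen k (Prel k a) j) = 0 := by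
  obtain ⟨h₁, h₂, h₃⟩ := hG
  have e₁ := congrArg (G 0 1 • ·) (gen_relation_xy a)
  have e₂ := congrArg (-G 2 2 • ·) (gen_relation_xz a)
  have e₃ := congrArg ((G 0 2 + G 2 2) • ·) (gen_relation_xyz a)
  simp only [Fin.sum_univ_three, hs.apply 0 1, hs.apply 0 2, hs.apply 1 2, h₁, h₂, h₃]
  simp only [smul_zero] at e₁ e₂ e₃
  have e := congrArg₂ (· + ·) (congrArg₂ (· + ·) e₁ e₂) e₃
  simp only [add_zero] at e
  rw [← e]
  simp only [pow_two, two_mul, mul_sub, sub_mul]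
  module

/-! ### A cubic whose polar conics are the relations -/

/-- The Hessian matrix, up to a factor `2`, of the ternary cubic whose polar conics span the
relations of `P(a)`. -/
def polarNet (a : k) (v : Fin 3 → k) : Matrix (Fin 3) (Fin 3) k :=
  !![a * v 0 - a * v 1, 2 * v 1 - a * v 0 - v 2, v 2 - v 1;
     2 * v 1 - a * v 0 - v 2, 2 * v 0 - 4 * v 1 + 2 * v 2, 2 * v 1 - v 0 - v 2;
     v 2 - v 1, 2 * v 1 - v 0 - v 2, v 0 - v 1]

/-- Half of the Hessian matrix of the cubic form `v ↦ det (polarNet a v)`. -/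
def hessianNet (a : k) (v : Fin 3 → k) : Matrix (Fin 3) (Fin 3) k :=
  (a - 1) • !![a * v 1 - 3 * a * v 0, a * v 0 + 2 * v 1 - v 2, v 2 - v 1;
     a * v 0 + 2 * v 1 - v 2, 2 * v 0 - 2 * v 2, v 2 - 2 * v 1 - v 0;
     v 2 - v 1, v 2 - 2 * v 1 - v 0, v 0 + v 1]

lemma polarNet_isSymm (a : k) (v : Fin 3 → k) : (polarNet a v).IsSymm := by
  ext i j
  fin_cases i <;> fin_cases j <;> simp [polarNet]

lemma inNet_polarNet (a : k) (v : Fin 3 → k) : InNet a (polarNet a v) := by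
  refine ⟨?_, ?_, ?_⟩ <;> simp [polarNet] <;> ring

lemma trace_adjugate_polarNet_mul_hessianNet (a : k) (v : Fin 3 → k) :
    ((polarNet a v).adjugate * hessianNet a v).trace =
      (a - 1) ^ 2 * (v ⬝ᵥ polarNet a v *ᵥ v) := by
  simp [polarNet, hessianNet, Matrix.adjugate_fin_three, Matrix.trace_fin_three,
    dotProduct, mulVec, Fin.sum_univ_three]
  ring

lemma trace_polarNet_mul_adjugate_hessianNet (a : k) (v : Fin 3 → k) :
    (polarNet a v * (hessianNet a v).adjugate).trace =
      -2 * (a - 1) ^ 2 * (a + 1) * (v ⬝ᵥ polarNet a v *ᵥ v)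
        - 3 * (a - 1) ^ 2 * (polarNet a v).det := by
  simp [polarNet, hessianNet, Matrix.adjugate_fin_three, Matrix.trace_fin_three,
    Matrix.det_fin_three, dotProduct, mulVec, Fin.sum_univ_three]
  ring

/-- Polarization of the cubic form `v ↦ det (polarNet a v)`. -/
lemma two_mul_dotProduct_hessianNet (a : k) (v y z : Fin 3 → k) :
    2 * (y ⬝ᵥ hessianNet a v *ᵥ z) =
      (polarNet a (v + y + z)).det - (polarNet a (v + y)).det - (polarNet a (v + z)).det
        - (polarNet a (y + z)).det + (polarNet a v).det + (polarNet a y).det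
        + (polarNet a z).det := by
  simp [polarNet, hessianNet, Matrix.det_fin_three, dotProduct, mulVec, Fin.sum_univ_three]
  ring

lemma polarNet_sum_single (a : k) (v : Fin 3 → k) :
    polarNet a v = ∑ i, v i • polarNet a (Pi.single i 1) := by
  ext i j
  fin_cases i <;> fin_cases j <;> simp [polarNet, Fin.sum_univ_three] <;> ring

/-- Symmetry of the trilinear form attached to `polarNet`. -/
lemma polarNet_mulVec_comm (a : k) (v w : Fin 3 → k) :
    polarNet a v *ᵥ w = polarNet a w *ᵥ v := by
  ext i
  fin_cases i <;> simp [polarNet, mulVec, dotProduct, Fin.sum_univ_three] <;> ring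

lemma dotProduct_conj_mulVec (T M : Matrix (Fin 3) (Fin 3) k) (y z : Fin 3 → k) :
    y ⬝ᵥ (Tᵀ * M * T) *ᵥ z = (T *ᵥ y) ⬝ᵥ M *ᵥ (T *ᵥ z) := by
  rw [← mulVec_mulVec, ← mulVec_mulVec, dotProduct_mulVec, vecMul_transpose]

/-- A symmetric trilinear form all of whose polars lie in the net of `P(a)` is a multiple of
the one attached to `polarNet`. -/
lemma eq_smul_polarNet {a : k} (ha : a ≠ 1) (g : Fin 3 → Matrix (Fin 3) (Fin 3) k)
    (hs : ∀ i j l, g i j l = g i l j) (hc : ∀ i j l, g i j l = g j i l)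
    (hg : ∀ i, InNet a (g i)) (i : Fin 3) :
    g i = g 0 2 2 • polarNet a (Pi.single i 1) := by
  obtain ⟨r₁, r₂, r₃⟩ := hg 0
  obtain ⟨s₁, s₂, s₃⟩ := hg 1
  obtain ⟨t₁, t₂, t₃⟩ := hg 2
  have c₁ := hc 0 1 0
  have c₂ := hc 0 1 1
  have c₃ := hc 0 1 2
  have c₄ := hc 0 2 0
  have c₅ := hc 0 2 1
  have c₆ := hc 0 2 2
  have c₇ := hc 1 2 0
  have c₈ := hc 1 2 1
  have c₉ := hc 1 2 2
  have d₁ := fun i => hs i 0 1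
  have d₂ := fun i => hs i 0 2
  have d₃ := fun i => hs i 1 2
  have hz : g 2 2 2 = 0 := by
    have : (a - 1) * g 2 2 2 = 0 := by grind
    exact (mul_eq_zero.mp this).resolve_left (sub_ne_zero.mpr ha)
  ext j l
  fin_cases i <;> fin_cases j <;> fin_cases l <;> simp [polarNet] <;> grind

lemma exists_conj_polarNet_eq_smul {a a' : k} (ha' : a' ≠ 1) (T : Matrix (Fin 3) (Fin 3) k)
    (hT : ∀ v, InNet a' (Tᵀ * polarNet a v * T)) :
    ∃ c : k, ∀ v, Tᵀ * polarNet a (T *ᵥ v) * T = c • polarNet a' v := by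
  set g : Fin 3 → Matrix (Fin 3) (Fin 3) k :=
    fun i => Tᵀ * polarNet a (T *ᵥ Pi.single i 1) * T with hg
  have hgapply (i j l) : g i j l =
      (T *ᵥ Pi.single j 1) ⬝ᵥ polarNet a (T *ᵥ Pi.single i 1) *ᵥ (T *ᵥ Pi.single l 1) := by
    rw [← dotProduct_conj_mulVec]
    simp [hg]
  have hs (i j l) : g i j l = g i l j := by
    have : (g i).IsSymm := by
      simp only [hg, Matrix.IsSymm, transpose_mul, transpose_transpose,
        (polarNet_isSymm a _).eq, Matrix.mul_assoc]
    exact this.apply l j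
  have hc (i j l) : g i j l = g j i l := by
    rw [hs i, hs j, hgapply, hgapply, polarNet_mulVec_comm]
  refine ⟨g 0 2 2, fun v => ?_⟩
  have hlin : Tᵀ * polarNet a (T *ᵥ v) * T = ∑ i, v i • g i := by
    ext j l
    have e (w : Fin 3 → k) : (Tᵀ * polarNet a (T *ᵥ w) * T) j l =
        (T *ᵥ Pi.single j 1) ⬝ᵥ polarNet a (T *ᵥ Pi.single l 1) *ᵥ (T *ᵥ w) := by
      rw [polarNet_mulVec_comm, ← dotProduct_conj_mulVec]
      simp
    rw [e, ← dotProduct_conj_mulVec]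
    simp only [Matrix.sum_apply, Matrix.smul_apply, hg, e, ← dotProduct_conj_mulVec]
    simp only [single_one_dotProduct, mulVec_single_one, col_apply]
    simp only [mulVec, dotProduct, mul_comm, smul_eq_mul]
  rw [hlin, polarNet_sum_single a' v, Finset.smul_sum]
  refine Finset.sum_congr rfl fun i _ => ?_
  rw [eq_smul_polarNet ha' g hs hc (fun i => hT _) i, smul_comm]

lemma ext_of_dotProduct_mulVec {M N : Matrix (Fin 3) (Fin 3) k}
    (h : ∀ y z : Fin 3 → k, y ⬝ᵥ M *ᵥ z = y ⬝ᵥ N *ᵥ z) : M = N := by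
  ext i j
  simpa using h (Pi.single i 1) (Pi.single j 1)

section Transformation

variable {a a' c : k} {T : Matrix (Fin 3) (Fin 3) k}

lemma det_polarNet_mulVec
    (hT : ∀ v, Tᵀ * polarNet a (T *ᵥ v) * T = c • polarNet a' v) (v : Fin 3 → k) :
    T.det ^ 2 * (polarNet a (T *ᵥ v)).det = c ^ 3 * (polarNet a' v).det := by
  have h := congrArg Matrix.det (hT v)
  simp only [det_mul, det_transpose, det_smul, Fintype.card_fin] at h
  linear_combination h

lemma conj_hessianNet (h2 : (2 : k) ≠ 0)
    (hT : ∀ v, Tᵀ * polarNet a (T *ᵥ v) * T = c • polarNet a' v) (v : Fin 3 → k) :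
    Tᵀ * (T.det ^ 2 • hessianNet a (T *ᵥ v)) * T = c ^ 3 • hessianNet a' v := by
  refine ext_of_dotProduct_mulVec fun y z => mul_left_cancel₀ h2 ?_
  rw [dotProduct_conj_mulVec, smul_mulVec, smul_mulVec, dotProduct_smul, dotProduct_smul,
    smul_eq_mul, smul_eq_mul, mul_left_comm, two_mul_dotProduct_hessianNet, mul_left_comm,
    two_mul_dotProduct_hessianNet]
  simp only [← mulVec_add]
  simp only [mul_sub, mul_add, det_polarNet_mulVec hT]

lemma dotProduct_polarNet_mulVec
    (hT : ∀ v, Tᵀ * polarNet a (T *ᵥ v) * T = c • polarNet a' v) (v : Fin 3 → k) :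
    (T *ᵥ v) ⬝ᵥ polarNet a (T *ᵥ v) *ᵥ (T *ᵥ v) = c * (v ⬝ᵥ polarNet a' v *ᵥ v) := by
  rw [← dotProduct_conj_mulVec, hT, smul_mulVec, dotProduct_smul, smul_eq_mul]

end Transformation

lemma trace_adjugate_conj_mul_conj (T M N : Matrix (Fin 3) (Fin 3) k) :
    ((Tᵀ * M * T).adjugate * (Tᵀ * N * T)).trace = T.det ^ 2 * (M.adjugate * N).trace := by
  have h : (Tᵀ * M * T).adjugate * (Tᵀ * N * T) =
      T.adjugate * (M.adjugate * (Tᵀ.adjugate * Tᵀ) * N) * T := by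
    simp only [adjugate_mul_distrib, Matrix.mul_assoc]
  rw [h, trace_mul_comm, ← Matrix.mul_assoc, mul_adjugate, adjugate_mul, det_transpose]
  simp [pow_two, mul_assoc]

theorem eq_or_mul_eq_one_of_conj_inNet {a a' : k} (h2 : (2 : k) ≠ 0) (ha : a ≠ 1)
    (ha' : a' ≠ 1) (T : Matrix (Fin 3) (Fin 3) k) (hdet : T.det ≠ 0)
    (hT : ∀ v, InNet a' (Tᵀ * polarNet a v * T)) : a' = a ∨ a * a' = 1 := by
  obtain ⟨c, hc⟩ := exists_conj_polarNet_eq_smul ha' T hT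
  set v : Fin 3 → k := ![0, 1, 0] with hv
  have hcubic : v ⬝ᵥ polarNet a' v *ᵥ v = -4 := by
    simp [hv, polarNet, dotProduct, mulVec, Fin.sum_univ_three]
  have hdet' : (polarNet a' v).det = 0 := by
    simp [hv, polarNet, det_fin_three]
    ring
  have hdetT : (polarNet a (T *ᵥ v)).det = 0 := by
    have h := det_polarNet_mulVec hc v
    rw [hdet', mul_zero] at h
    exact (mul_eq_zero.mp h).resolve_left (pow_ne_zero 2 hdet)
  have h4 : (4 : k) ≠ 0 := by
    rw [show (4 : k) = 2 * 2 by norm_num]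
    exact mul_ne_zero h2 h2
  have hc0 : c ≠ 0 := by
    rintro rfl
    have h := det_polarNet_mulVec hc (T⁻¹ *ᵥ ![0, 1, 1])
    rw [mulVec_mulVec, mul_nonsing_inv T (isUnit_iff_ne_zero.mpr hdet), one_mulVec] at h
    have hw : (polarNet a ![0, 1, 1]).det = -(a - 1) := by
      simp [polarNet, det_fin_three]
      ring
    simp [hw, hdet, sub_eq_zero, ha.symm] at h
  have hS : T.det ^ 4 * (a - 1) ^ 2 = c ^ 4 * (a' - 1) ^ 2 := by
    have h := trace_adjugate_conj_mul_conj T (polarNet a (T *ᵥ v))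
      (T.det ^ 2 • hessianNet a (T *ᵥ v))
    rw [hc, conj_hessianNet h2 hc, adjugate_smul] at h
    simp only [Fintype.card_fin, smul_mul_smul_comm, Matrix.mul_smul, trace_smul, smul_eq_mul,
      trace_adjugate_polarNet_mul_hessianNet, dotProduct_polarNet_mulVec hc, hcubic] at h
    refine mul_left_cancel₀ (mul_ne_zero hc0 h4) ?_
    linear_combination h
  have hR : T.det ^ 6 * ((a - 1) ^ 2 * (a + 1)) = c ^ 6 * ((a' - 1) ^ 2 * (a' + 1)) := by
    have h := trace_adjugate_conj_mul_conj T (T.det ^ 2 • hessianNet a (T *ᵥ v))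
      (polarNet a (T *ᵥ v))
    rw [hc, conj_hessianNet h2 hc, trace_mul_comm, trace_mul_comm (adjugate _), adjugate_smul,
      adjugate_smul] at h
    simp only [Fintype.card_fin, smul_mul_smul_comm, Matrix.mul_smul, trace_smul, smul_eq_mul,
      trace_polarNet_mul_adjugate_hessianNet, dotProduct_polarNet_mulVec hc, hcubic, hdet',
      hdetT] at h
    refine mul_left_cancel₀ (mul_ne_zero (mul_ne_zero hc0 h4) h2) ?_
    linear_combination -h
  have ha1 := sub_ne_zero.mpr ha
  have key : ((a + 1) * (a' - 1)) ^ 2 = ((a - 1) * (a' + 1)) ^ 2 := by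
    refine mul_left_cancel₀ (mul_ne_zero (pow_ne_zero 12 hdet) (pow_ne_zero 4 ha1)) ?_
    have h3 : (T.det ^ 4 * (a - 1) ^ 2) ^ 3 = (c ^ 4 * (a' - 1) ^ 2) ^ 3 := by rw [hS]
    have h6 : (T.det ^ 6 * ((a - 1) ^ 2 * (a + 1))) ^ 2 =
      (c ^ 6 * ((a' - 1) ^ 2 * (a' + 1))) ^ 2 := by rw [hR]
    linear_combination (a' - 1) ^ 2 * h6 - (a' + 1) ^ 2 * h3
  rcases sq_eq_sq_iff_eq_or_eq_neg.mp key with h | h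
  · left
    refine mul_left_cancel₀ h2 ?_
    linear_combination h
  · right
    refine mul_left_cancel₀ h2 ?_
    linear_combination h

/-! ### Graded isomorphisms -/

lemma exists_matrix_of_gradedIso {a a' : k} (h : GradedIso k (Prel k a) (Prel k a')) :
    ∃ T : Matrix (Fin 3) (Fin 3) k, T.det ≠ 0 ∧ ∀ v, InNet a' (Tᵀ * polarNet a v * T) := by
  obtain ⟨φ, hφ⟩ := h
  have hmem (i) : φ (gen k (Prel k a) i) ∈ genSpan k (Prel k a') :=
    hφ ▸ Submodule.mem_map_of_mem (Submodule.subset_span ⟨i, rfl⟩)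
  have hmem' (j) : ∃ x ∈ genSpan k (Prel k a), φ x = gen k (Prel k a') j := by
    have : gen k (Prel k a') j ∈ Submodule.map φ.toLinearMap (genSpan k (Prel k a)) :=
      hφ ▸ Submodule.subset_span ⟨j, rfl⟩
    exact Submodule.mem_map.mp this
  simp only [genSpan, Submodule.mem_span_range_iff_exists_fun] at hmem hmem'
  choose T hT using hmem
  choose x hx hφx using hmem'
  choose U hU using hx
  have hUT : (Matrix.of U) * (Matrix.of T) = 1 := by
    ext j l
    have h : ∑ l, ((Matrix.of U * Matrix.of T) j l) • gen k (Prel k a') l =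
        ∑ l, ((1 : Matrix (Fin 3) (Fin 3) k) j l) • gen k (Prel k a') l := by
      calc _ = φ (x j) := by
            rw [← hU]
            simp only [map_sum, map_smul, ← hT, Finset.smul_sum, Matrix.mul_apply, Finset.sum_smul,
              mul_smul, Matrix.of_apply]
            exact Finset.sum_comm
        _ = _ := by simp [hφx, Matrix.one_apply]
    exact congrFun ((linearIndependent_gen a').fintypeLinearCombination_injective h) l
  refine ⟨Matrix.of T, fun h0 => ?_, fun v => inNet_of_sum_eq_zero ?_⟩
  · simpa [h0] using congrArg Matrix.det hUT
  · have h := congrArg φ (sum_eq_zero_of_inNet (polarNet_isSymm a v) (inNet_polarNet a v))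
    rw [map_zero] at h
    rw [← h]
    simp only [map_sum, map_smul, map_mul, ← hT]
    generalize polarNet a v = M
    generalize gen k (Prel k a') = g
    simp only [Fin.sum_univ_three, Matrix.mul_apply, Matrix.transpose_apply, Matrix.of_apply,
      mul_add, add_mul, smul_mul_smul_comm]
    module

/-- The substitution `r ↦ s, s ↦ r, t ↦ c (t - s) + r`. -/
def swapHom {a a' c : k} (hc : c ^ 2 = a) (h : a * a' = 1) :
    quotAlg k (Prel k a) →ₐ[k] quotAlg k (Prel k a') :=
  liftP a ![gen k (Prel k a') 1, gen k (Prel k a') 0,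
      c • (gen k (Prel k a') 2 - gen k (Prel k a') 1) + gen k (Prel k a') 0]
    (by
      simp only [Matrix.cons_val]
      rw [add_comm]
      exact gen_relation_xy a')
    (by
      subst hc
      simp only [Matrix.cons_val]
      linear_combination (norm := skip) (1 + c) • gen_relation_xy a' + c ^ 2 • gen_relation_xz a'
        - (c ^ 2 + c) • gen_relation_xyz a'
      simp only [pow_two, two_mul, mul_add, add_mul, mul_sub, sub_mul, smul_sub, smul_mul_assoc,
        mul_smul_comm]
      match_scalars <;> first | ring1 | linear_combination h)
    (by
      simp only [Matrix.cons_val]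
      linear_combination (norm := skip) (1 + c) • gen_relation_xy a' - c • gen_relation_xyz a'
      simp only [pow_two, two_mul, mul_add, add_mul, mul_sub, sub_mul, smul_sub, smul_mul_assoc,
        mul_smul_comm]
      module)

lemma swapHom_comp_swapHom {a a' c c' : k} (hc : c ^ 2 = a) (h : a * a' = 1) (hc' : c' ^ 2 = a')
    (h' : a' * a = 1) (hcc' : c * c' = 1) :
    (swapHom hc' h').comp (swapHom hc h) = AlgHom.id k _ := by
  refine RingQuot.ringQuot_ext' k _ _ (FreeAlgebra.hom_ext (funext fun i => ?_))
  change swapHom hc' h' (swapHom hc h (gen k (Prel k a) i)) = gen k (Prel k a) i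
  fin_cases i <;> simp [swapHom, smul_smul, hcc']

lemma swapHom_gen_mem {a a' c : k} (hc : c ^ 2 = a) (h : a * a' = 1) (i : Fin 3) :
    swapHom hc h (gen k (Prel k a) i) ∈ genSpan k (Prel k a') := by
  have hg (j) : gen k (Prel k a') j ∈ genSpan k (Prel k a') := Submodule.subset_span ⟨j, rfl⟩
  rw [swapHom, liftP_gen]
  fin_cases i
  · exact hg 1
  · exact hg 0
  · exact add_mem (Submodule.smul_mem _ _ (sub_mem (hg 2) (hg 1))) (hg 0)

lemma gradedIso_of_mul_eq_one [IsAlgClosed k] {a a' : k} (h : a * a' = 1) :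
    GradedIso k (Prel k a) (Prel k a') := by
  obtain ⟨c, hc⟩ := IsAlgClosed.exists_pow_nat_eq a two_pos
  have h' : a' * a = 1 := by rw [mul_comm, h]
  have hc0 : c ≠ 0 := by
    rintro rfl
    simp [← hc] at h
  have hc' : c⁻¹ ^ 2 = a' := by rw [inv_pow, hc, inv_eq_of_mul_eq_one_right h]
  have hinv := swapHom_comp_swapHom hc' h' hc h (inv_mul_cancel₀ hc0)
  refine ⟨AlgEquiv.ofAlgHom (swapHom hc h) (swapHom hc' h') hinv
    (swapHom_comp_swapHom hc h hc' h' (mul_inv_cancel₀ hc0)), le_antisymm ?_ ?_⟩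
  · rw [genSpan, Submodule.map_span_le]
    rintro _ ⟨i, rfl⟩
    exact swapHom_gen_mem hc h i
  · rw [genSpan, Submodule.span_le]
    rintro _ ⟨i, rfl⟩
    exact ⟨_, swapHom_gen_mem hc' h' i, DFunLike.congr_fun hinv _⟩

lemma gradedIso_refl (rels : Set (F3 k)) : GradedIso k rels rels :=
  ⟨AlgEquiv.refl, Submodule.map_id _⟩

end

theorem stmt18 (k : Type) [Field k] [IsAlgClosed k]
    (hchar2 : ringChar k ≠ 2) (hchar3 : ringChar k ≠ 3)
    (a a' : k) (ha : a * (a - 1) ≠ 0) (ha' : a' * (a' - 1) ≠ 0) :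
    GradedIso k (Prel k a) (Prel k a') ↔ a' = a ∨ a * a' = 1 := by
  have h2 : (2 : k) ≠ 0 := Ring.two_ne_zero hchar2
  have ne_one {b : k} (hb : b * (b - 1) ≠ 0) : b ≠ 1 :=
    sub_ne_zero.mp (right_ne_zero_of_mul hb)
  constructor
  · intro h
    obtain ⟨T, hdet, hT⟩ := exists_matrix_of_gradedIso h
    exact eq_or_mul_eq_one_of_conj_inNet h2 (ne_one ha) (ne_one ha') T hdet hT
  · rintro (rfl | h)
    · exact gradedIso_refl _
    · exact gradedIso_of_mul_eq_one h
end
end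

section
/- Let k be an algebraically closed field of characteristic 0. (1) For every a ∈ k with a(a−1) ≠ 0, there exists c ∈ k with c ≠ 0 and (3c)³ ≠ (2+c³)³ such that P(a) is graded-isomorphic to the Sklyanin algebra S(1,1,c). (2) Conversely, for every c ∈ k with c ≠ 0 and (3c)³ ≠ (2+c³)³, there exists a ∈ k with a(a−1) ≠ 0 such that S(1,1,c) is graded-isomorphic to P(a). -/
noncomputable section

/-- Relations of the Sklyanin algebra `S(1,1,c)`:
`⟨yz + zy + c·x², zx + xz + c·y², xy + yx + c·z²⟩`. -/
noncomputable def S11rel (k : Type) [Field k] (c : k) : Set (F3 k) :=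
  {Y k * Z k + Z k * Y k + c • X k ^ 2,
   Z k * X k + X k * Z k + c • Y k ^ 2,
   X k * Y k + Y k * X k + c • Z k ^ 2}

section GradedIsomorphisms

variable {k : Type} [Field k]

/-- The linear forms in the generators of a quotient algebra given by the rows of a matrix. -/
def linForm (rels : Set (F3 k)) (M : Matrix (Fin 3) (Fin 3) k) (i : Fin 3) : quotAlg k rels :=
  ∑ j, M i j • gen k rels j

/-- The algebra map out of a quotient of the free algebra determined by images of the
generators which satisfy the relations. -/
def quotLift {A : Type} [Ring A] [Algebra k A] (rels : Set (F3 k)) (f : Fin 3 → A)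
    (hf : ∀ p ∈ rels, FreeAlgebra.lift k f p = 0) : quotAlg k rels →ₐ[k] A :=
  RingQuot.liftAlgHom k ⟨FreeAlgebra.lift k f, by
    rintro p q ⟨hp, rfl⟩
    rw [hf p hp, map_zero]⟩

lemma quotLift_gen {A : Type} [Ring A] [Algebra k A] (rels : Set (F3 k)) (f : Fin 3 → A)
    (hf : ∀ p ∈ rels, FreeAlgebra.lift k f p = 0) (i : Fin 3) :
    quotLift rels f hf (gen k rels i) = f i := by
  simp [quotLift, gen]

lemma lift_gen_eq_zero (rels : Set (F3 k)) {p : F3 k} (hp : p ∈ rels) :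
    FreeAlgebra.lift k (gen k rels) p = 0 := by
  have h : FreeAlgebra.lift k (gen k rels) =
      RingQuot.mkAlgHom k (fun a b : F3 k => a ∈ rels ∧ b = 0) := by
    ext i
    simp [gen]
  rw [h, RingQuot.mkAlgHom_rel k (s := fun a b : F3 k => a ∈ rels ∧ b = 0) ⟨hp, rfl⟩, map_zero]

lemma quotAlg_hom_ext {A : Type} [Ring A] [Algebra k A] (rels : Set (F3 k))
    {f g : quotAlg k rels →ₐ[k] A} (h : ∀ i, f (gen k rels i) = g (gen k rels i)) : f = g := by
  apply RingQuot.ringQuot_ext'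
  ext i
  exact h i

lemma quotLift_linForm {r₁ r₂ : Set (F3 k)} {M N : Matrix (Fin 3) (Fin 3) k} (hMN : M * N = 1)
    (hN : ∀ p ∈ r₂, FreeAlgebra.lift k (linForm r₁ N) p = 0) (i : Fin 3) :
    quotLift r₂ (linForm r₁ N) hN (linForm r₂ M i) = gen k r₁ i := by
  have h : ∀ l, ∑ j, M i j * N j l = (1 : Matrix (Fin 3) (Fin 3) k) i l := fun l => by
    rw [← hMN, Matrix.mul_apply]
  simp only [linForm, map_sum, map_smul, quotLift_gen, Finset.smul_sum, smul_smul]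
  rw [Finset.sum_comm]
  simp only [← Finset.sum_smul, h]
  simp [Matrix.one_apply]

lemma linForm_mem_genSpan (rels : Set (F3 k)) (M : Matrix (Fin 3) (Fin 3) k) (i : Fin 3) :
    linForm rels M i ∈ genSpan k rels :=
  Submodule.sum_mem _ fun j _ =>
    Submodule.smul_mem _ _ (Submodule.subset_span (Set.mem_range_self j))

/-- An invertible linear substitution which carries the relations of each algebra to relations of
the other one induces a graded isomorphism. -/
lemma gradedIso_of_matrix {r₁ r₂ : Set (F3 k)} (M N : Matrix (Fin 3) (Fin 3) k) (hMN : M * N = 1)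
    (hM : ∀ p ∈ r₁, FreeAlgebra.lift k (linForm r₂ M) p = 0)
    (hN : ∀ p ∈ r₂, FreeAlgebra.lift k (linForm r₁ N) p = 0) : GradedIso k r₁ r₂ := by
  have hNM : N * M = 1 := mul_eq_one_comm.mp hMN
  let φ := quotLift r₁ (linForm r₂ M) hM
  let ψ := quotLift r₂ (linForm r₁ N) hN
  have hφ : ∀ i, φ (gen k r₁ i) = linForm r₂ M i := quotLift_gen _ _ hM
  have hψ : ∀ i, ψ (gen k r₂ i) = linForm r₁ N i := quotLift_gen _ _ hN
  have hφψ : φ.comp ψ = AlgHom.id k _ := quotAlg_hom_ext _ fun i => by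
    rw [AlgHom.comp_apply, hψ]
    exact quotLift_linForm hNM hM i
  have hψφ : ψ.comp φ = AlgHom.id k _ := quotAlg_hom_ext _ fun i => by
    rw [AlgHom.comp_apply, hφ]
    exact quotLift_linForm hMN hN i
  refine ⟨AlgEquiv.ofAlgHom φ ψ hφψ hψφ, le_antisymm ?_ ?_⟩
  · rw [genSpan, Submodule.map_span_le]
    rintro _ ⟨i, rfl⟩
    change φ (gen k r₁ i) ∈ _
    rw [hφ]
    exact linForm_mem_genSpan _ _ _
  · rw [genSpan, Submodule.span_le]
    rintro _ ⟨i, rfl⟩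
    exact ⟨linForm r₁ N i, linForm_mem_genSpan _ _ _, quotLift_linForm hNM hM i⟩

lemma GradedIso.symm {r₁ r₂ : Set (F3 k)} (h : GradedIso k r₁ r₂) : GradedIso k r₂ r₁ := by
  obtain ⟨φ, hφ⟩ := h
  refine ⟨φ.symm, ?_⟩
  rw [← hφ, ← Submodule.map_comp]
  convert Submodule.map_id _
  ext x
  simp

lemma GradedIso.trans {r₁ r₂ r₃ : Set (F3 k)} (h : GradedIso k r₁ r₂) (h' : GradedIso k r₂ r₃) :
    GradedIso k r₁ r₃ := by
  obtain ⟨φ, hφ⟩ := h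
  obtain ⟨ψ, hψ⟩ := h'
  refine ⟨φ.trans ψ, ?_⟩
  rw [← hψ, ← hφ, ← Submodule.map_comp]
  rfl

/-- The relations `uv + vu`, `2r² - rv - vr`, `u² - b r² + v²` in generators `r, u, v`: the polars
of the Weierstrass cubic `3u²v + 2b r³ - 3b r²v + v³`. -/
def weierstrassRel (k : Type) [Field k] (b : k) : Set (F3 k) :=
  {Y k * Z k + Z k * Y k,
   2 * X k ^ 2 - X k * Z k - Z k * X k,
   Y k ^ 2 - b • X k ^ 2 + Z k ^ 2}

/-- The relations `uv + vu`, `α p² - β (pv + vp) + γ v²`, `2u² - β p² + γ (pv + vp) - δ v²` in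
generators `p, u, v`: the polars of the cubic `6u²v + α p³ - 3β p²v + 3γ pv² - δ v³`. -/
def cubicRel (k : Type) [Field k] (α β γ δ : k) : Set (F3 k) :=
  {Y k * Z k + Z k * Y k,
   α • X k ^ 2 - β • (X k * Z k + Z k * X k) + γ • Z k ^ 2,
   (2 : k) • Y k ^ 2 - β • X k ^ 2 + γ • (X k * Z k + Z k * X k) - δ • Z k ^ 2}

lemma lift_Prel_eq_zero_iff {A : Type} [Ring A] [Algebra k A] {f : Fin 3 → A} {a : k} :
    (∀ p ∈ Prel k a, FreeAlgebra.lift k f p = 0) ↔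
      f 0 * f 1 + f 1 * f 0 = 0 ∧
      f 2 * f 0 + f 0 * f 2 - f 2 ^ 2 - a • f 0 ^ 2 = 0 ∧
      f 2 * (f 0 - f 1) + (f 0 - f 1) * f 2 + 2 * f 1 ^ 2 = 0 := by
  simp [Prel, X, Y, Z, map_ofNat (FreeAlgebra.lift k f) 2]

lemma lift_S11rel_eq_zero_iff {A : Type} [Ring A] [Algebra k A] {f : Fin 3 → A} {c : k} :
    (∀ p ∈ S11rel k c, FreeAlgebra.lift k f p = 0) ↔
      f 1 * f 2 + f 2 * f 1 + c • f 0 ^ 2 = 0 ∧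
      f 2 * f 0 + f 0 * f 2 + c • f 1 ^ 2 = 0 ∧
      f 0 * f 1 + f 1 * f 0 + c • f 2 ^ 2 = 0 := by
  simp [S11rel, X, Y, Z]

lemma lift_weierstrassRel_eq_zero_iff {A : Type} [Ring A] [Algebra k A] {f : Fin 3 → A} {b : k} :
    (∀ p ∈ weierstrassRel k b, FreeAlgebra.lift k f p = 0) ↔
      f 1 * f 2 + f 2 * f 1 = 0 ∧
      2 * f 0 ^ 2 - f 0 * f 2 - f 2 * f 0 = 0 ∧
      f 1 ^ 2 - b • f 0 ^ 2 + f 2 ^ 2 = 0 := by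
  simp [weierstrassRel, X, Y, Z, map_ofNat (FreeAlgebra.lift k f) 2]

lemma lift_cubicRel_eq_zero_iff {A : Type} [Ring A] [Algebra k A] {f : Fin 3 → A}
    {α β γ δ : k} :
    (∀ p ∈ cubicRel k α β γ δ, FreeAlgebra.lift k f p = 0) ↔
      f 1 * f 2 + f 2 * f 1 = 0 ∧
      α • f 0 ^ 2 - β • (f 0 * f 2 + f 2 * f 0) + γ • f 2 ^ 2 = 0 ∧
      (2 : k) • f 1 ^ 2 - β • f 0 ^ 2 + γ • (f 0 * f 2 + f 2 * f 0) - δ • f 2 ^ 2 = 0 := by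
  simp [cubicRel, X, Y, Z]

set_option linter.unusedSimpArgs false

lemma gradedIso_Prel_weierstrassRel (a : k) :
    GradedIso k (Prel k a) (weierstrassRel k (1 - a)) := by
  refine gradedIso_of_matrix !![1, 0, 0; 1, 0, -1; 1, 1, -1] !![1, 0, 0; 0, -1, 1; 1, -1, 0]
    ?_ ?_ ?_
  · ext i j
    fin_cases i <;> fin_cases j <;> simp [Matrix.mul_apply, Fin.sum_univ_three]
  · obtain ⟨h₁, h₂, h₃⟩ := lift_weierstrassRel_eq_zero_iff.1
      fun _ => lift_gen_eq_zero (weierstrassRel k (1 - a))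
    rw [lift_Prel_eq_zero_iff]
    simp only [linForm, Fin.sum_univ_three, Matrix.of_apply, Matrix.cons_val]
    refine ⟨?_, ?_, ?_⟩
    · linear_combination (norm := skip) h₂
      simp only [pow_two, mul_add, add_mul, mul_sub, sub_mul, smul_mul_assoc, mul_smul_comm,
        two_mul]
      match_scalars <;> ring
    · linear_combination (norm := skip) h₁ - h₃
      simp only [pow_two, mul_add, add_mul, mul_sub, sub_mul, smul_mul_assoc, mul_smul_comm,
        two_mul]
      match_scalars <;> ring
    · linear_combination (norm := skip) h₁ + h₂
      simp only [pow_two, mul_add, add_mul, mul_sub, sub_mul, smul_mul_assoc, mul_smul_comm,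
        two_mul]
      match_scalars <;> ring
  · obtain ⟨h₁, h₂, h₃⟩ := lift_Prel_eq_zero_iff.1
      fun _ => lift_gen_eq_zero (Prel k a)
    rw [lift_weierstrassRel_eq_zero_iff]
    simp only [linForm, Fin.sum_univ_three, Matrix.of_apply, Matrix.cons_val]
    refine ⟨?_, ?_, ?_⟩
    · linear_combination (norm := skip) h₃ - h₁
      simp only [pow_two, mul_add, add_mul, mul_sub, sub_mul, smul_mul_assoc, mul_smul_comm,
        two_mul]
      match_scalars <;> ring
    · linear_combination (norm := skip) h₁
      simp only [pow_two, mul_add, add_mul, mul_sub, sub_mul, smul_mul_assoc, mul_smul_comm,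
        two_mul]
      match_scalars <;> ring
    · linear_combination (norm := skip) h₃ - h₁ - h₂
      simp only [pow_two, mul_add, add_mul, mul_sub, sub_mul, smul_mul_assoc, mul_smul_comm,
        two_mul]
      match_scalars <;> ring

/-- The generators are `p = x + y`, `u = x - y`, `v = c p - 2 z`; here `v = 0` is an inflectional
tangent of the cubic `c (x³ + y³ + z³) + 6xyz`. -/
lemma gradedIso_S11rel_cubicRel [CharZero k] (c : k) :
    GradedIso k (S11rel k c) (cubicRel k (8 * c + c ^ 4) (2 + c ^ 3) (c ^ 2) c) := by
  refine gradedIso_of_matrix !![1 / 2, 1 / 2, 0; 1 / 2, -1 / 2, 0; c / 2, 0, -1 / 2]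
    !![1, 1, 0; 1, -1, 0; c, c, -2] ?_ ?_ ?_
  · ext i j
    fin_cases i <;> fin_cases j <;> simp [Matrix.mul_apply, Fin.sum_univ_three] <;> ring
  · obtain ⟨h₁, h₂, h₃⟩ := lift_cubicRel_eq_zero_iff.1
      fun _ => lift_gen_eq_zero (cubicRel k (8 * c + c ^ 4) (2 + c ^ 3) (c ^ 2) c)
    rw [lift_S11rel_eq_zero_iff]
    simp only [linForm, Fin.sum_univ_three, Matrix.of_apply, Matrix.cons_val]
    refine ⟨?_, ?_, ?_⟩
    · linear_combination (norm := skip) (1 / 4 : k) • h₁ + (1 / 8 : k) • h₂ + (c / 8) • h₃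
      simp only [pow_two, mul_add, add_mul, mul_sub, sub_mul, smul_mul_assoc, mul_smul_comm,
        two_mul]
      match_scalars <;> ring
    · linear_combination (norm := skip) -(1 / 4 : k) • h₁ + (1 / 8 : k) • h₂ + (c / 8) • h₃
      simp only [pow_two, mul_add, add_mul, mul_sub, sub_mul, smul_mul_assoc, mul_smul_comm,
        two_mul]
      match_scalars <;> ring
    · linear_combination (norm := skip) -(1 / 4 : k) • h₃
      simp only [pow_two, mul_add, add_mul, mul_sub, sub_mul, smul_mul_assoc, mul_smul_comm,
        two_mul]
      match_scalars <;> ring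
  · obtain ⟨h₁, h₂, h₃⟩ := lift_S11rel_eq_zero_iff.1
      fun _ => lift_gen_eq_zero (S11rel k c)
    rw [lift_cubicRel_eq_zero_iff]
    simp only [linForm, Fin.sum_univ_three, Matrix.of_apply, Matrix.cons_val]
    refine ⟨?_, ?_, ?_⟩
    · linear_combination (norm := skip) (2 : k) • h₁ - (2 : k) • h₂
      simp only [pow_two, mul_add, add_mul, mul_sub, sub_mul, smul_mul_assoc, mul_smul_comm,
        two_mul]
      match_scalars <;> ring
    · linear_combination (norm := skip) (4 : k) • h₁ + (4 : k) • h₂ + (4 * c) • h₃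
      simp only [pow_two, mul_add, add_mul, mul_sub, sub_mul, smul_mul_assoc, mul_smul_comm,
        two_mul]
      match_scalars <;> ring
    · linear_combination (norm := skip) -(4 : k) • h₃
      simp only [pow_two, mul_add, add_mul, mul_sub, sub_mul, smul_mul_assoc, mul_smul_comm,
        two_mul]
      match_scalars <;> ring

/-- The substitution `p = e r + q v`, `u ↦ w u` moves the critical points `q`, `q + e` of the
binary cubic part of the cubic belonging to `cubicRel` to `0`, `1`. -/
lemma gradedIso_cubicRel_weierstrassRel [CharZero k] {α β γ δ b e q w : k} (he : e ≠ 0)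
    (hw : w ≠ 0) (hα : α ≠ 0) (hq : α * q ^ 2 - 2 * β * q + γ = 0)
    (hqe : α * e = 2 * (β - α * q))
    (hD : 2 * w ^ 2 = -β * q ^ 2 + 2 * γ * q - δ)
    (hb : 2 * b * w ^ 2 = β * e ^ 2 + 2 * e * (β * q - γ)) :
    GradedIso k (cubicRel k α β γ δ) (weierstrassRel k b) := by
  refine gradedIso_of_matrix !![e, 0, q; 0, w, 0; 0, 0, 1]
    !![1 / e, 0, -q / e; 0, 1 / w, 0; 0, 0, 1] ?_ ?_ ?_
  · ext i j
    fin_cases i <;> fin_cases j <;> simp [Matrix.mul_apply, Fin.sum_univ_three, he, hw]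
    field_simp
    ring
  · obtain ⟨h₁, h₂, h₃⟩ := lift_weierstrassRel_eq_zero_iff.1
      fun _ => lift_gen_eq_zero (weierstrassRel k b)
    rw [lift_cubicRel_eq_zero_iff]
    simp only [linForm, Fin.sum_univ_three, Matrix.of_apply, Matrix.cons_val]
    refine ⟨?_, ?_, ?_⟩
    · linear_combination (norm := skip) w • h₁
      simp only [pow_two, mul_add, add_mul, mul_sub, sub_mul, smul_mul_assoc, mul_smul_comm,
        two_mul]
      match_scalars <;> ring
    · linear_combination (norm := skip) (α * e ^ 2 / 2) • h₂
      simp only [pow_two, mul_add, add_mul, mul_sub, sub_mul, smul_mul_assoc, mul_smul_comm,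
        two_mul]
      match_scalars <;> first
        | ring1
        | linear_combination hq
        | linear_combination (e / 2) * hqe
    · linear_combination (norm := skip) (2 * w ^ 2) • h₃ + (e * (β * q - γ)) • h₂
      simp only [pow_two, mul_add, add_mul, mul_sub, sub_mul, smul_mul_assoc, mul_smul_comm,
        two_mul]
      match_scalars <;> first
        | ring1
        | linear_combination hb
        | linear_combination -hD
  · obtain ⟨h₁, h₂, h₃⟩ := lift_cubicRel_eq_zero_iff.1
      fun _ => lift_gen_eq_zero (cubicRel k α β γ δ)
    rw [lift_weierstrassRel_eq_zero_iff]
    simp only [linForm, Fin.sum_univ_three, Matrix.of_apply, Matrix.cons_val]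
    refine ⟨?_, ?_, ?_⟩
    · linear_combination (norm := skip) (1 / w) • h₁
      simp only [pow_two, mul_add, add_mul, mul_sub, sub_mul, smul_mul_assoc, mul_smul_comm,
        two_mul]
      match_scalars <;> ring
    · linear_combination (norm := skip) (2 / (α * e ^ 2)) • h₂
      simp only [pow_two, mul_add, add_mul, mul_sub, sub_mul, smul_mul_assoc, mul_smul_comm,
        two_mul]
      match_scalars <;> field_simp <;> grind
    · linear_combination (norm := skip) (1 / (2 * w ^ 2)) • h₃ -
        ((β * q - γ) / (α * e * w ^ 2)) • h₂
      simp only [pow_two, mul_add, add_mul, mul_sub, sub_mul, smul_mul_assoc, mul_smul_comm,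
        two_mul]
      match_scalars <;> field_simp <;> grind

/-- If `c³ + d² = 1` and `a = (3 - d)³(1 + d) / ((3 + d)³(1 - d))`, then `P(a)` is isomorphic to
`S(1,1,c)`. -/
lemma gradedIso_Prel_S11rel [IsAlgClosed k] [CharZero k] {a c d : k} (hcd : c ^ 3 = 1 - d ^ 2)
    (hc : c ≠ 0) (hd : d ≠ 0) (h3 : 3 + d ≠ 0) (h3' : 3 - d ≠ 0)
    (ha : a * ((3 + d) ^ 3 * (1 - d)) = (3 - d) ^ 3 * (1 + d)) :
    GradedIso k (Prel k a) (S11rel k c) := by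
  refine (gradedIso_Prel_weierstrassRel a).trans
    ((gradedIso_S11rel_cubicRel c).trans ?_).symm
  have h1 : (1 - d) * (1 + d) ≠ 0 := by
    rw [show (1 - d) * (1 + d) = c ^ 3 by rw [hcd]; ring]
    exact pow_ne_zero 3 hc
  have hd1 : 1 - d ≠ 0 := left_ne_zero_of_mul h1
  have hα : 8 * c + c ^ 4 = c * ((3 + d) * (3 - d)) := by linear_combination c * hcd
  have hβ : 2 + c ^ 3 = 3 - d ^ 2 := by linear_combination hcd
  obtain ⟨w, hw⟩ := IsAlgClosed.exists_pow_nat_eq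
    (-((3 + d) * (1 - d)) / (c ^ 2 * (3 - d) ^ 2)) (n := 2) two_pos
  have hw0 : w ≠ 0 := by
    rintro rfl
    have : -((3 + d) * (1 - d)) / (c ^ 2 * (3 - d) ^ 2) ≠ 0 :=
      div_ne_zero (neg_ne_zero.2 (by positivity)) (by positivity)
    exact this (by rw [← hw]; ring)
  refine gradedIso_cubicRel_weierstrassRel (e := 4 * d / (c * ((3 + d) * (3 - d))))
    (q := (1 - d) / (c * (3 - d))) (w := w) ?_ hw0 ?_ ?_ ?_ ?_ ?_
  · have : (4 : k) ≠ 0 := by norm_num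
    positivity
  · rw [hα]
    positivity
  · rw [hα, hβ]
    field_simp
    linear_combination (3 - d) * hcd
  · rw [hα, hβ]
    field_simp
    ring
  · rw [hw, hβ]
    field_simp
    linear_combination (3 + 2 * d - d ^ 2) * hcd
  · rw [hw, hβ]
    field_simp
    linear_combination (72 * d - 8 * d ^ 3) * hcd + 2 * ha

lemma exists_quartic_root [IsAlgClosed k] {a₄ : k} (h : a₄ ≠ 0) (a₃ a₂ a₁ a₀ : k) :
    ∃ x, a₄ * x ^ 4 + a₃ * x ^ 3 + a₂ * x ^ 2 + a₁ * x + a₀ = 0 := by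
  have hdeg : (.C a₄ * .X ^ 4 + .C a₃ * .X ^ 3 + .C a₂ * .X ^ 2 + .C a₁ * .X + .C a₀ :
      Polynomial k).degree = 4 := by
    compute_degree!
  obtain ⟨x, hx⟩ := IsAlgClosed.exists_root _ (by rw [hdeg]; decide)
  exact ⟨x, by simpa using hx⟩

end GradedIsomorphisms

theorem stmt19 (k : Type) [Field k] [IsAlgClosed k] [CharZero k] :
    (∀ a : k, a * (a - 1) ≠ 0 →
      ∃ c : k, c ≠ 0 ∧ (3 * c) ^ 3 ≠ (2 + c ^ 3) ^ 3 ∧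
        GradedIso k (Prel k a) (S11rel k c)) ∧
    (∀ c : k, c ≠ 0 → (3 * c) ^ 3 ≠ (2 + c ^ 3) ^ 3 →
      ∃ a : k, a * (a - 1) ≠ 0 ∧ GradedIso k (S11rel k c) (Prel k a)) := by
  have key : ∀ c d : k, c ^ 3 = 1 - d ^ 2 →
      (2 + c ^ 3) ^ 3 - (3 * c) ^ 3 = d ^ 4 * ((3 + d) * (3 - d)) := fun c d h => by
    rw [mul_pow, h]
    ring
  refine ⟨fun a ha => ?_, fun c hc hc' => ?_⟩
  · have ha0 : a ≠ 0 := left_ne_zero_of_mul ha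
    have ha1 : 1 - a ≠ 0 := fun h => right_ne_zero_of_mul ha (by linear_combination -h)
    obtain ⟨d, hd⟩ := exists_quartic_root ha1 (-8 * (1 + a)) (18 * (1 - a)) 0 (27 * (a - 1))
    have hd' : a * ((3 + d) ^ 3 * (1 - d)) = (3 - d) ^ 3 * (1 + d) := by linear_combination hd
    obtain ⟨c, hcd⟩ := IsAlgClosed.exists_pow_nat_eq (1 - d ^ 2) (n := 3) three_pos
    have hd0 : d ≠ 0 := by
      rintro rfl
      exact ha1 (by linear_combination -hd' / 27)
    have h3 : 3 + d ≠ 0 := by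
      intro h
      obtain rfl : d = -3 := by linear_combination h
      norm_num at hd'
    have h3' : 3 - d ≠ 0 := by
      intro h
      obtain rfl : d = 3 := by linear_combination -h
      norm_num at hd'
      exact ha0 hd'
    have hc : c ≠ 0 := by
      rintro rfl
      have : (1 - d) * (1 + d) = 0 := by linear_combination -hcd
      rcases mul_eq_zero.1 this with h | h
      · obtain rfl : d = 1 := by linear_combination -h
        norm_num at hd'
      · obtain rfl : d = -1 := by linear_combination h
        norm_num at hd'
        exact ha0 hd'
    refine ⟨c, hc, fun h => ?_, gradedIso_Prel_S11rel hcd hc hd0 h3 h3' hd'⟩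
    have := key c d hcd
    rw [h, sub_self] at this
    exact mul_ne_zero (pow_ne_zero 4 hd0) (mul_ne_zero h3 h3') this.symm
  · obtain ⟨d, hd⟩ := IsAlgClosed.exists_pow_nat_eq (1 - c ^ 3) (n := 2) two_pos
    have hcd : c ^ 3 = 1 - d ^ 2 := by rw [hd]; ring
    have hne : d ^ 4 * ((3 + d) * (3 - d)) ≠ 0 := by
      rw [← key c d hcd]
      exact sub_ne_zero.2 hc'.symm
    have hd0 : d ≠ 0 := by
      rintro rfl
      simp at hne
    have h3 : 3 + d ≠ 0 := left_ne_zero_of_mul (right_ne_zero_of_mul hne)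
    have h3' : 3 - d ≠ 0 := right_ne_zero_of_mul (right_ne_zero_of_mul hne)
    have h1 : (1 - d) * (1 + d) ≠ 0 := by
      rw [show (1 - d) * (1 + d) = c ^ 3 by rw [hcd]; ring]
      exact pow_ne_zero 3 hc
    have hm : 1 - d ≠ 0 := left_ne_zero_of_mul h1
    have hp : 1 + d ≠ 0 := right_ne_zero_of_mul h1
    refine ⟨(3 - d) ^ 3 * (1 + d) / ((3 + d) ^ 3 * (1 - d)), mul_ne_zero (by positivity) ?_,
      (gradedIso_Prel_S11rel hcd hc hd0 h3 h3' (by field_simp)).symm⟩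
    rw [show (3 - d) ^ 3 * (1 + d) / ((3 + d) ^ 3 * (1 - d)) - 1 =
      16 * d ^ 3 / ((3 + d) ^ 3 * (1 - d)) by field_simp; ring]
    have : (16 : k) ≠ 0 := by norm_num
    positivity
end
end
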